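/- For any nonzero real numbers α₁, α₂, α₃ there exists a constant C > 0 such that for every natural number n and every set E of n points in ℝ², the number of ordered triples (x₁, x₂, x₃) of pairwise distinct points of E with x₁ · x₂ = α₁, x₂ · x₃ = α₂, and x₃ · x₁ = α₃ is at most C · n^(4/3). -/

import Mathlib

open scoped InnerProductSpace

noncomputable section

/-- Points in the plane. -/
abbrev Pt2 : Type := EuclideanSpace ℝ (Fin 2)

/-- The set of dot product `C₃`-configurations (dot product triangles) of type
`(α₁, α₂, α₃)` in a point set `E`: ordered triples of pairwise distinct points of `E`
with the three prescribed pairwise dot products. -/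
def dpTriangles (E : Finset Pt2) (α₁ α₂ α₃ : ℝ) : Set (Pt2 × Pt2 × Pt2) :=
  {x | x.1 ∈ E ∧ x.2.1 ∈ E ∧ x.2.2 ∈ E ∧
    x.1 ≠ x.2.1 ∧ x.1 ≠ x.2.2 ∧ x.2.1 ≠ x.2.2 ∧
    ⟪x.1, x.2.1⟫_ℝ = α₁ ∧ ⟪x.2.1, x.2.2⟫_ℝ = α₂ ∧ ⟪x.2.2, x.1⟫_ℝ = α₃}

/-- Slope of the segment joining `e.1` to `e.2`. -/
def segSlope (e : (ℝ × ℝ) × (ℝ × ℝ)) : ℝ := (e.2.2 - e.1.2) / (e.2.1 - e.1.1)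

/-- Height at abscissa `x` of the line through `e.1` and `e.2`. -/
def segHeight (e : (ℝ × ℝ) × (ℝ × ℝ)) (x : ℝ) : ℝ := e.1.2 + segSlope e * (x - e.1.1)

/-- Two distinct segments whose relative interiors meet. -/
def SegCross (e f : (ℝ × ℝ) × (ℝ × ℝ)) : Prop :=
  e ≠ f ∧ ∃ x, e.1.1 < x ∧ f.1.1 < x ∧ x < e.2.1 ∧ x < f.2.1 ∧ segHeight e x = segHeight f x

/-- A straight-line graph in the plane: vertices have distinct abscissas, edges are directed from
left to right, and no vertex lies in the relative interior of an edge. -/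
structure IsGeometricGraph (V : Finset (ℝ × ℝ)) (G : Finset ((ℝ × ℝ) × (ℝ × ℝ))) : Prop where
  injOn : Set.InjOn Prod.fst (V : Set (ℝ × ℝ))
  left_mem : ∀ e ∈ G, e.1 ∈ V
  right_mem : ∀ e ∈ G, e.2 ∈ V
  lt : ∀ e ∈ G, e.1.1 < e.2.1
  notMem_interior : ∀ e ∈ G, ∀ z ∈ V, e.1.1 < z.1 → z.1 < e.2.1 → segHeight e z.1 ≠ z.2

@[simp] lemma segHeight_left (e : (ℝ × ℝ) × (ℝ × ℝ)) : segHeight e e.1.1 = e.1.2 := by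
  simp [segHeight]

lemma segHeight_right {e : (ℝ × ℝ) × (ℝ × ℝ)} (h : e.1.1 < e.2.1) :
    segHeight e e.2.1 = e.2.2 := by
  have : e.2.1 - e.1.1 ≠ 0 := by linarith
  rw [segHeight, segSlope, div_mul_cancel₀ _ this]
  ring

/-- If one line is strictly below another at `c` and they do not meet on `(a, c)`, then it is
weakly below at `a`. -/
lemma segHeight_le_of_forall_ne {e f : (ℝ × ℝ) × (ℝ × ℝ)} {a c : ℝ} (hac : a ≤ c)
    (hne : ∀ x, a < x → x < c → segHeight e x ≠ segHeight f x)
    (hc : segHeight e c < segHeight f c) : segHeight e a ≤ segHeight f a := by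
  by_contra! ha
  rcases hac.eq_or_lt with rfl | hac
  · linarith
  have hd : 0 < (segHeight e a - segHeight f a) + (segHeight f c - segHeight e c) := by linarith
  set d := (segHeight e a - segHeight f a) + (segHeight f c - segHeight e c) with hdef
  refine hne ((a * (segHeight f c - segHeight e c) + c * (segHeight e a - segHeight f a)) / d)
    ?_ ?_ ?_
  · rw [lt_div_iff₀ hd]
    nlinarith
  · rw [div_lt_iff₀ hd]
    nlinarith
  · have h (g : (ℝ × ℝ) × (ℝ × ℝ)) (y : ℝ) :
        segHeight g (y / d) * d = g.1.2 * d + segSlope g * (y - g.1.1 * d) := by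
      unfold segHeight
      field_simp
    refine mul_right_cancel₀ hd.ne' ?_
    rw [h, h, hdef]
    unfold segHeight
    ring

namespace IsGeometricGraph

variable {V : Finset (ℝ × ℝ)} {G : Finset ((ℝ × ℝ) × (ℝ × ℝ))}

/-- In a crossing-free graph, consider two edges `e`, `f` leaving `e.1` to the right with no edge
leaving `e.1` between them. If the wedge between them contains no vertex left of abscissa `t`, then
no edge passes between them at abscissa `t`. -/
lemma not_between (hG : IsGeometricGraph V G) (hX : ∀ e ∈ G, ∀ f ∈ G, ¬ SegCross e f)
    {e f g : (ℝ × ℝ) × (ℝ × ℝ)} (he : e ∈ G) (hf : f ∈ G) (hg : g ∈ G) (hfe : f.1 = e.1)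
    (hmin : ∀ k ∈ G, k.1 = e.1 → segSlope e < segSlope k → segSlope f ≤ segSlope k)
    {t : ℝ} (het : e.1.1 < t) (hte : t ≤ e.2.1) (htf : t ≤ f.2.1)
    (hz : ∀ z ∈ V, e.1.1 < z.1 → z.1 < t → segHeight e z.1 ≤ z.2 → z.2 ≤ segHeight f z.1 → False)
    (hgt : g.1.1 < t) (htg : t ≤ g.2.1)
    (h₁ : segHeight e t < segHeight g t) (h₂ : segHeight g t < segHeight f t) : False := by
  have heg : e ≠ g := by rintro rfl; exact lt_irrefl _ h₁
  have hgf : g ≠ f := by rintro rfl; exact lt_irrefl _ h₂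
  have hfe1 : f.1.1 = e.1.1 := by rw [hfe]
  have hfe2 : f.1.2 = e.1.2 := by rw [hfe]
  have key : ∀ a, e.1.1 ≤ a → g.1.1 ≤ a → a ≤ t →
      segHeight e a ≤ segHeight g a ∧ segHeight g a ≤ segHeight f a := by
    intro a h1 h2 h3
    constructor
    · refine segHeight_le_of_forall_ne h3 (fun x hx hx' h => ?_) h₁
      exact hX e he g hg ⟨heg, x, by linarith, by linarith, by linarith, by linarith, h⟩
    · refine segHeight_le_of_forall_ne h3 (fun x hx hx' h => ?_) h₂
      exact hX g hg f hf ⟨hgf, x, by linarith, by linarith, by linarith, by linarith, h⟩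
  rcases lt_or_ge e.1.1 g.1.1 with hlt | hge
  · obtain ⟨k1, k2⟩ := key g.1.1 hlt.le le_rfl hgt.le
    rw [segHeight_left] at k1 k2
    exact hz g.1 (hG.left_mem g hg) hlt hgt k1 k2
  · obtain ⟨k1, k2⟩ := key e.1.1 le_rfl hge het.le
    have k3 : segHeight f e.1.1 = e.1.2 := by rw [← hfe, segHeight_left]
    rw [segHeight_left] at k1
    have k4 : segHeight g e.1.1 = e.1.2 := by linarith
    rcases hge.eq_or_lt with heq | hlt
    · have hge1 : g.1 = e.1 := hG.injOn (hG.left_mem g hg) (hG.left_mem e he) heq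
      have hpos : 0 < t - e.1.1 := by linarith
      simp only [segHeight, hge1, hfe] at h₁ h₂
      have s1 : segSlope e < segSlope g := lt_of_mul_lt_mul_right (by linarith) hpos.le
      have s2 : segSlope g < segSlope f := lt_of_mul_lt_mul_right (by linarith) hpos.le
      exact absurd (hmin g hg hge1 s1) (not_le.mpr s2)
    · exact hG.notMem_interior g hg e.1 (hG.left_mem e he) hlt (by linarith) k4

/-- A crossing-free straight-line graph has at most three times as many edges as vertices. -/
theorem card_le_of_not_cross (hG : IsGeometricGraph V G)
    (hX : ∀ e ∈ G, ∀ f ∈ G, ¬ SegCross e f) : G.card ≤ 3 * V.card := by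
  classical
  have uniq : ∀ e ∈ G, ∀ f ∈ G, ∀ x, e.1.1 < x → f.1.1 < x → x < e.2.1 → x < f.2.1 →
      segHeight e x = segHeight f x → e = f := fun e he f hf x h1 h2 h3 h4 h5 => by
    by_contra hne
    exact hX e he f hf ⟨hne, x, h1, h2, h3, h4, h5⟩
  set A := G.filter fun e => ∀ f ∈ G, f.1 = e.1 → segSlope f ≤ segSlope e with hA
  set B := G.filter fun e => ∃ f ∈ G, f.1 = e.1 ∧ e.2.1 < f.2.1 ∧ e.2.2 < segHeight f e.2.1 ∧
    ∀ g ∈ G, g.1.1 < e.2.1 → e.2.1 ≤ g.2.1 → e.2.2 < segHeight g e.2.1 →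
      segHeight f e.2.1 ≤ segHeight g e.2.1 with hB
  set C := G.filter fun e => ∃ z ∈ V, e.1.1 < z.1 ∧ z.1 < e.2.1 ∧ segHeight e z.1 < z.2 ∧
    ∀ g ∈ G, g.1.1 < z.1 → z.1 ≤ g.2.1 → segHeight g z.1 < z.2 →
      segHeight g z.1 ≤ segHeight e z.1 with hC
  have hcover : G ⊆ A ∪ (B ∪ C) := by
    intro e he
    by_cases hAe : ∀ f ∈ G, f.1 = e.1 → segSlope f ≤ segSlope e
    · exact Finset.mem_union_left _ (Finset.mem_filter.mpr ⟨he, hAe⟩)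
    refine Finset.mem_union_right _ ?_
    push Not at hAe
    have hne : (G.filter fun f => f.1 = e.1 ∧ segSlope e < segSlope f).Nonempty := by
      obtain ⟨f, h⟩ := hAe
      exact ⟨f, Finset.mem_filter.mpr h⟩
    obtain ⟨f, hf, hfmin⟩ := Finset.exists_min_image _ segSlope hne
    obtain ⟨hfG, hfe, hef⟩ := Finset.mem_filter.mp hf
    have hmin : ∀ k ∈ G, k.1 = e.1 → segSlope e < segSlope k → segSlope f ≤ segSlope k :=
      fun k hk h1 h2 => hfmin k (Finset.mem_filter.mpr ⟨hk, h1, h2⟩)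
    have hlt : ∀ x, e.1.1 < x → segHeight e x < segHeight f x := fun x hx => by
      simp only [segHeight, hfe]
      have := mul_lt_mul_of_pos_right hef (sub_pos.mpr hx)
      linarith
    have hele := hG.lt e he
    have hfle := hG.lt f hfG
    have hfe1 : f.1.1 = e.1.1 := by rw [hfe]
    have hZ : (V.filter fun z => e.1.1 < z.1 ∧ z.1 ≤ e.2.1 ∧ z.1 ≤ f.2.1 ∧
        segHeight e z.1 ≤ z.2 ∧ z.2 ≤ segHeight f z.1).Nonempty := by
      rcases le_total e.2.1 f.2.1 with h | h
      · refine ⟨e.2, Finset.mem_filter.mpr ⟨hG.right_mem e he, hele, le_rfl, h, ?_, ?_⟩⟩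
        · exact (segHeight_right hele).le
        · rw [← segHeight_right hele]
          exact (hlt _ hele).le
      · refine ⟨f.2, Finset.mem_filter.mpr ⟨hG.right_mem f hfG, by linarith, h, le_rfl, ?_, ?_⟩⟩
        · rw [← segHeight_right hfle]
          exact (hlt _ (by linarith)).le
        · exact (segHeight_right hfle).ge
    obtain ⟨z, hz, hzmin⟩ := Finset.exists_min_image _ Prod.fst hZ
    obtain ⟨hzV, z1, z2, z3, z4, z5⟩ := Finset.mem_filter.mp hz
    have hempty : ∀ y ∈ V, e.1.1 < y.1 → y.1 < z.1 → segHeight e y.1 ≤ y.2 →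
        y.2 ≤ segHeight f y.1 → False := fun y hy h1 h2 h3 h4 => by
      have := hzmin y (Finset.mem_filter.mpr ⟨hy, h1, by linarith, by linarith, h3, h4⟩)
      linarith
    by_cases hze : z = e.2
    · subst hze
      refine Finset.mem_union_left _ (Finset.mem_filter.mpr ⟨he, f, hfG, hfe, ?_, ?_, ?_⟩)
      · refine z3.lt_of_ne fun h => ?_
        have h' := hG.injOn (hG.right_mem e he) (hG.right_mem f hfG) h
        have : f = e := Prod.ext hfe h'.symm
        rw [this] at hef
        exact lt_irrefl _ hef
      · conv_lhs => rw [← segHeight_right hele]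
        exact hlt _ hele
      · intro g hg h1 h2 h3
        by_contra! h4
        rw [← segHeight_right hele] at h3
        exact hG.not_between hX he hfG hg hfe hmin z1 z2 z3 hempty h1 h2 h3 h4
    · have hlt' : z.1 < e.2.1 :=
        z2.lt_of_ne fun h => hze (hG.injOn hzV (hG.right_mem e he) h)
      refine Finset.mem_union_right _ (Finset.mem_filter.mpr ⟨he, z, hzV, z1, hlt', ?_, ?_⟩)
      · exact z4.lt_of_ne (hG.notMem_interior e he z hzV z1 hlt')
      · intro g hg h1 h2 h3
        by_contra! h4
        exact hG.not_between hX he hfG hg hfe hmin z1 z2 z3 hempty h1 h2 h4 (by linarith)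
  have cardA : A.card ≤ V.card := by
    refine Finset.card_le_card_of_injOn Prod.fst
      (fun e he => hG.left_mem e (Finset.mem_filter.mp he).1) ?_
    intro e he f hf hef
    obtain ⟨he, he'⟩ := Finset.mem_filter.mp he
    obtain ⟨hf, hf'⟩ := Finset.mem_filter.mp hf
    have hef : e.1 = f.1 := hef
    have hs : segSlope e = segSlope f := le_antisymm (hf' e he hef) (he' f hf hef.symm)
    have h1 := hG.lt e he
    have h2 := hG.lt f hf
    have hef1 : e.1.1 = f.1.1 := by rw [hef]
    obtain ⟨x, hx, hx'⟩ := exists_between (lt_min h1 (by linarith : e.1.1 < f.2.1))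
    exact uniq e he f hf x hx (by linarith) (hx'.trans_le (min_le_left _ _))
      (hx'.trans_le (min_le_right _ _)) (by simp [segHeight, hs, hef])
  have cardB : B.card ≤ V.card := by
    refine Finset.card_le_card_of_injOn Prod.snd
      (fun e he => hG.right_mem e (Finset.mem_filter.mp he).1) ?_
    intro e he e' he' hee
    obtain ⟨he, f, hf, hfe, h1, h2, h3⟩ := Finset.mem_filter.mp he
    obtain ⟨he', f', hf', hfe', h1', h2', h3'⟩ := Finset.mem_filter.mp he'
    have hee : e.2 = e'.2 := hee
    have l1 := hG.lt e he
    have l2 := hG.lt e' he'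
    rw [← hee] at h1' h2' h3' l2
    rw [← hfe] at l1
    rw [← hfe'] at l2
    have hff : f = f' := uniq f hf f' hf' e.2.1 l1 l2 h1 h1'
      (le_antisymm (h3 f' hf' l2 h1'.le h2') (h3' f hf l1 h1.le h2))
    exact Prod.ext (by rw [← hfe, ← hfe', hff]) hee
  have cardC : C.card ≤ V.card := by
    have hex : ∀ e ∈ C, ∃ z ∈ V, e.1.1 < z.1 ∧ z.1 < e.2.1 ∧ segHeight e z.1 < z.2 ∧
        ∀ g ∈ G, g.1.1 < z.1 → z.1 ≤ g.2.1 → segHeight g z.1 < z.2 →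
          segHeight g z.1 ≤ segHeight e z.1 := fun e he => (Finset.mem_filter.mp he).2
    choose! z hzV h1 h2 h3 h4 using hex
    refine Finset.card_le_card_of_injOn z hzV ?_
    intro e he e' he' hee
    have heG := (Finset.mem_filter.mp he).1
    have heG' := (Finset.mem_filter.mp he').1
    have a1 := h1 e' he'
    have a2 := h2 e' he'
    have a3 := h3 e' he'
    have a4 := h4 e' he'
    rw [← hee] at a1 a2 a3 a4
    exact uniq e heG e' heG' (z e).1 (h1 e he) a1 (h2 e he) a2
      (le_antisymm (a4 e heG (h1 e he) (h2 e he).le (h3 e he))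
        (h4 e he e' heG' a1 a2.le a3))
  have := Finset.card_le_card hcover
  have := Finset.card_union_le A (B ∪ C)
  have := Finset.card_union_le B C
  omega

end IsGeometricGraph

/-- Keep each element of `V` independently with probability `p`. If every member of a family `A`
is indexed by a `k`-subset of `V`, the expected number of members that survive is `#A * p ^ k`. -/
lemma sum_powerset_weight_mul_card {α ι : Type*} [DecidableEq α] (V : Finset α) (A : Finset ι)
    (T : ι → Finset α) (k : ℕ) (hT : ∀ a ∈ A, T a ⊆ V) (hk : ∀ a ∈ A, (T a).card = k) (p : ℝ) :
    ∑ S ∈ V.powerset, p ^ S.card * (1 - p) ^ (V \ S).card *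
      ((A.filter fun a => T a ⊆ S).card : ℝ) = A.card * p ^ k := by
  have h : ∀ a ∈ A, ∑ S ∈ V.powerset, p ^ S.card * (1 - p) ^ (V \ S).card *
      (if T a ⊆ S then 1 else 0) = p ^ k := by
    intro a ha
    have h1 := Finset.prod_add (fun _ => p) (fun i => if i ∈ T a then 0 else 1 - p) V
    have h2 : ∏ i ∈ V, (p + if i ∈ T a then 0 else 1 - p) = p ^ k := by
      have : ∀ i ∈ V, (p + if i ∈ T a then 0 else 1 - p) = if i ∈ T a then p else 1 := by
        intro i _
        split_ifs <;> ring
      rw [Finset.prod_congr rfl this, Finset.prod_ite_mem,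
        Finset.inter_eq_right.mpr (hT a ha), Finset.prod_const, hk a ha]
    rw [← h2, h1]
    refine Finset.sum_congr rfl fun S hS => ?_
    rw [Finset.prod_const, mul_assoc]
    congr 1
    split_ifs with hTS
    · rw [mul_one, ← Finset.prod_const]
      refine Finset.prod_congr rfl fun i hi => ?_
      rw [if_neg fun hi' => (Finset.mem_sdiff.mp hi).2 (hTS hi')]
    · obtain ⟨i, hi, hiS⟩ := Finset.not_subset.mp hTS
      rw [mul_zero, eq_comm]
      exact Finset.prod_eq_zero (Finset.mem_sdiff.mpr ⟨hT a ha hi, hiS⟩) (if_pos hi)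
  simp_rw [Finset.card_filter, Nat.cast_sum, Finset.mul_sum]
  rw [Finset.sum_comm]
  push_cast
  rw [Finset.sum_congr rfl h, Finset.sum_const, nsmul_eq_mul]

open Classical in
/-- The ordered pairs of crossing edges. -/
def crossingPairs (G : Finset ((ℝ × ℝ) × (ℝ × ℝ))) :
    Finset (((ℝ × ℝ) × (ℝ × ℝ)) × ((ℝ × ℝ) × (ℝ × ℝ))) :=
  (G ×ˢ G).filter fun p => SegCross p.1 p.2

namespace IsGeometricGraph

variable {V : Finset (ℝ × ℝ)} {G : Finset ((ℝ × ℝ) × (ℝ × ℝ))}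

lemma mono (hG : IsGeometricGraph V G) {V' : Finset (ℝ × ℝ)} {G' : Finset ((ℝ × ℝ) × (ℝ × ℝ))}
    (hV : V' ⊆ V) (hG' : G' ⊆ G) (hl : ∀ e ∈ G', e.1 ∈ V') (hr : ∀ e ∈ G', e.2 ∈ V') :
    IsGeometricGraph V' G' where
  injOn := hG.injOn.mono (Finset.coe_subset.mpr hV)
  left_mem := hl
  right_mem := hr
  lt e he := hG.lt e (hG' he)
  notMem_interior e he z hz := hG.notMem_interior e (hG' he) z (hV hz)

lemma card_le_add_crossingPairs (hG : IsGeometricGraph V G) :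
    G.card ≤ 3 * V.card + (crossingPairs G).card := by
  classical
  set H := G.filter fun e => ∀ f ∈ G, ¬ SegCross e f with hH
  have h1 : H.card ≤ 3 * V.card := by
    refine (hG.mono subset_rfl (Finset.filter_subset _ _)
      (fun e he => hG.left_mem e (Finset.mem_filter.mp he).1)
      (fun e he => hG.right_mem e (Finset.mem_filter.mp he).1)).card_le_of_not_cross ?_
    intro e he f hf
    exact (Finset.mem_filter.mp he).2 f (Finset.mem_filter.mp hf).1
  have h2 : (G \ H) ⊆ (crossingPairs G).image Prod.fst := by
    intro e he
    obtain ⟨he, heH⟩ := Finset.mem_sdiff.mp he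
    have : ¬ ∀ f ∈ G, ¬ SegCross e f := fun h => heH (Finset.mem_filter.mpr ⟨he, h⟩)
    push Not at this
    obtain ⟨f, hf, hef⟩ := this
    exact Finset.mem_image.mpr ⟨(e, f),
      Finset.mem_filter.mpr ⟨Finset.mem_product.mpr ⟨he, hf⟩, hef⟩, rfl⟩
  have h3 := (Finset.card_le_card h2).trans Finset.card_image_le
  have h4 : (G \ H).card + H.card = G.card :=
    Finset.card_sdiff_add_card_eq_card (Finset.filter_subset _ _)
  omega

/-- Crossing edges have four distinct endpoints. -/
lemma card_endpoints_of_segCross (hG : IsGeometricGraph V G)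
    {e f : (ℝ × ℝ) × (ℝ × ℝ)} (he : e ∈ G) (hf : f ∈ G) (hX : SegCross e f) :
    ({e.1, e.2, f.1, f.2} : Finset (ℝ × ℝ)).card = 4 := by
  obtain ⟨hne, x, h1, h2, h3, h4, h5⟩ := hX
  have hee := hG.lt e he
  have hff := hG.lt f hf
  have aux : ∀ e f : (ℝ × ℝ) × (ℝ × ℝ), segSlope e = segSlope f → segHeight e x = segHeight f x →
      ∀ y, segHeight e y = segHeight f y := by
    intro e f hs hx y
    simp only [segHeight, hs] at hx ⊢
    linarith
  have aux' : ∀ e f : (ℝ × ℝ) × (ℝ × ℝ), ∀ a, a ≠ x → segHeight e a = segHeight f a →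
      segHeight e x = segHeight f x → ∀ y, segHeight e y = segHeight f y := by
    intro e f a hax ha hx
    refine aux e f ?_ hx
    have : (segSlope e - segSlope f) * (a - x) = 0 := by
      simp only [segHeight] at ha hx
      linear_combination ha - hx
    rcases mul_eq_zero.mp this with h | h
    · linarith
    · exact absurd (by linarith) hax
  have d1 : e.1 ≠ e.2 := fun h => by rw [h] at hee; exact lt_irrefl _ hee
  have d2 : f.1 ≠ f.2 := fun h => by rw [h] at hff; exact lt_irrefl _ hff
  have d3 : e.1 ≠ f.2 := fun h => by rw [h] at h1; linarith
  have d4 : e.2 ≠ f.1 := fun h => by rw [h] at h3; linarith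
  have d5 : e.1 ≠ f.1 := fun h => by
    have hy := aux' e f e.1.1 h1.ne (by rw [segHeight_left, h, segHeight_left]) h5
    rcases lt_trichotomy e.2.1 f.2.1 with hlt | heq | hgt
    · refine hG.notMem_interior f hf e.2 (hG.right_mem e he) (by linarith) hlt ?_
      rw [← hy, segHeight_right hee]
    · exact hne (Prod.ext h (hG.injOn (hG.right_mem e he) (hG.right_mem f hf) heq))
    · refine hG.notMem_interior e he f.2 (hG.right_mem f hf) (by linarith) hgt ?_
      rw [hy, segHeight_right hff]
  have d6 : e.2 ≠ f.2 := fun h => by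
    have hy := aux' e f e.2.1 h3.ne'
      (by rw [segHeight_right hee, h, segHeight_right hff]) h5
    rcases lt_trichotomy e.1.1 f.1.1 with hlt | heq | hgt
    · refine hG.notMem_interior e he f.1 (hG.left_mem f hf) hlt (by linarith) ?_
      rw [hy, segHeight_left]
    · exact d5 (hG.injOn (hG.left_mem e he) (hG.left_mem f hf) heq)
    · refine hG.notMem_interior f hf e.1 (hG.left_mem e he) hgt (by linarith) ?_
      rw [← hy, segHeight_left]
  rw [Finset.card_insert_of_notMem (by simp [d1, d3, d5]),
    Finset.card_insert_of_notMem (by simp [d4, d6]), Finset.card_pair d2]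

lemma card_mul_sq_le (hG : IsGeometricGraph V G) {p : ℝ} (hp0 : 0 ≤ p) (hp1 : p ≤ 1) :
    (G.card : ℝ) * p ^ 2 ≤ 3 * (V.card * p ^ 1) + (crossingPairs G).card * p ^ 4 := by
  classical
  rw [← sum_powerset_weight_mul_card V G (fun e => {e.1, e.2}) 2 ?_ ?_ p,
    ← sum_powerset_weight_mul_card V V (fun v => {v}) 1 ?_ ?_ p,
    ← sum_powerset_weight_mul_card V (crossingPairs G) (fun q => {q.1.1, q.1.2, q.2.1, q.2.2}) 4
      ?_ ?_ p, Finset.mul_sum, ← Finset.sum_add_distrib]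
  · refine Finset.sum_le_sum fun S hS => ?_
    have hSV := Finset.mem_powerset.mp hS
    set GS := G.filter fun e => ({e.1, e.2} : Finset (ℝ × ℝ)) ⊆ S with hGS
    have hGS' : ∀ e, e ∈ GS ↔ e ∈ G ∧ e.1 ∈ S ∧ e.2 ∈ S := fun e => by
      simp [hGS, Finset.insert_subset_iff]
    have h1 := (hG.mono hSV (Finset.filter_subset _ _ : GS ⊆ G)
      (fun e he => ((hGS' e).mp he).2.1)
      (fun e he => ((hGS' e).mp he).2.2)).card_le_add_crossingPairs
    have h2 : V.filter (fun v => {v} ⊆ S) = S := by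
      ext v
      simpa using fun h => hSV h
    have h3 : crossingPairs GS ⊆ (crossingPairs G).filter
        fun q => ({q.1.1, q.1.2, q.2.1, q.2.2} : Finset (ℝ × ℝ)) ⊆ S := by
      intro q hq
      simp only [crossingPairs, Finset.mem_filter, Finset.mem_product, hGS',
        Finset.insert_subset_iff, Finset.singleton_subset_iff] at hq ⊢
      tauto
    have h4 := Finset.card_le_card h3
    rw [h2]
    have h5 : (GS.card : ℝ) ≤ 3 * S.card + ((crossingPairs G).filter
        fun q => ({q.1.1, q.1.2, q.2.1, q.2.2} : Finset (ℝ × ℝ)) ⊆ S).card := by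
      exact_mod_cast h1.trans (Nat.add_le_add_left h4 _)
    have hw : 0 ≤ p ^ S.card * (1 - p) ^ (V \ S).card := by
      have : 0 ≤ 1 - p := by linarith
      positivity
    have := mul_le_mul_of_nonneg_left h5 hw
    linarith
  · intro q hq
    simp only [crossingPairs, Finset.mem_filter, Finset.mem_product] at hq
    simp [Finset.insert_subset_iff, hG.left_mem _ hq.1.1, hG.left_mem _ hq.1.2,
      hG.right_mem _ hq.1.1, hG.right_mem _ hq.1.2]
  · intro q hq
    simp only [crossingPairs, Finset.mem_filter, Finset.mem_product] at hq
    exact hG.card_endpoints_of_segCross hq.1.1 hq.1.2 hq.2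
  · intro v hv
    simpa using hv
  · intro v _
    simp
  · intro e he
    simp [Finset.insert_subset_iff, hG.left_mem _ he, hG.right_mem _ he]
  · intro e he
    refine Finset.card_pair fun h => ?_
    have := hG.lt e he
    rw [h] at this
    exact lt_irrefl _ this

/-- The crossing inequality for straight-line graphs. -/
theorem card_pow_three_le (hG : IsGeometricGraph V G) (h : 6 * V.card ≤ G.card) :
    (G.card : ℝ) ^ 3 ≤ 72 * (V.card : ℝ) ^ 2 * (crossingPairs G).card := by
  rcases Nat.eq_zero_or_pos G.card with h0 | hpos
  · rw [h0]
    simp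
    positivity
  obtain ⟨e₀, he₀⟩ := Finset.card_pos.mp hpos
  have hV : 0 < V.card := Finset.card_pos.mpr ⟨_, hG.left_mem _ he₀⟩
  have hV' : (0 : ℝ) < V.card := by exact_mod_cast hV
  have hpos' : (0 : ℝ) < G.card := by exact_mod_cast hpos
  have h' : 6 * (V.card : ℝ) ≤ G.card := by exact_mod_cast h
  have key := hG.card_mul_sq_le (p := 6 * V.card / G.card) (by positivity)
    ((div_le_one hpos').mpr h')
  set v : ℝ := (V.card : ℝ)
  set e : ℝ := (G.card : ℝ)
  set X : ℝ := ((crossingPairs G).card : ℝ)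
  have k := mul_le_mul_of_nonneg_right key (by positivity : 0 ≤ e ^ 4 / (18 * v ^ 2))
  have e1 : e * (6 * v / e) ^ 2 * (e ^ 4 / (18 * v ^ 2)) = 2 * e ^ 3 := by
    field_simp
    ring
  have e2 : (3 * (v * (6 * v / e) ^ 1) + X * (6 * v / e) ^ 4) * (e ^ 4 / (18 * v ^ 2))
      = e ^ 3 + 72 * v ^ 2 * X := by
    field_simp
    ring
  rw [e1, e2] at k
  linarith

end IsGeometricGraph

/-- `u` and `v` are consecutive points of `P`, from left to right, on the line
`y = ℓ.1 * x + ℓ.2`. -/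
def ConsecutiveOn (P : Finset (ℝ × ℝ)) (ℓ u v : ℝ × ℝ) : Prop :=
  u.2 = ℓ.1 * u.1 + ℓ.2 ∧ v.2 = ℓ.1 * v.1 + ℓ.2 ∧ u.1 < v.1 ∧
    ∀ w ∈ P, w.2 = ℓ.1 * w.1 + ℓ.2 → u.1 < w.1 → v.1 ≤ w.1

lemma ConsecutiveOn.segHeight_eq {P : Finset (ℝ × ℝ)} {ℓ u v : ℝ × ℝ}
    (h : ConsecutiveOn P ℓ u v) (x : ℝ) : segHeight (u, v) x = ℓ.1 * x + ℓ.2 := by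
  obtain ⟨h1, h2, h3, -⟩ := h
  have : v.1 - u.1 ≠ 0 := by linarith
  simp only [segHeight, segSlope, h1, h2]
  field_simp
  ring

lemma ConsecutiveOn.eq_of_mem_interior {P : Finset (ℝ × ℝ)}
    (hP : Set.InjOn Prod.fst (P : Set (ℝ × ℝ))) {ℓ u v u' v' : ℝ × ℝ}
    (h : ConsecutiveOn P ℓ u v) (h' : ConsecutiveOn P ℓ u' v') (hu : u ∈ P) (hv : v ∈ P)
    (hu' : u' ∈ P) (hv' : v' ∈ P) {x : ℝ} (h1 : u.1 < x) (h2 : x < v.1) (h3 : u'.1 < x)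
    (h4 : x < v'.1) : u = u' ∧ v = v' := by
  obtain ⟨a1, a2, a3, a4⟩ := h
  obtain ⟨b1, b2, b3, b4⟩ := h'
  constructor
  · refine hP hu hu' (le_antisymm ?_ ?_)
    · by_contra! hlt
      linarith [b4 u hu a1 hlt]
    · by_contra! hlt
      linarith [a4 u' hu' b1 hlt]
  · exact hP hv hv' (le_antisymm (a4 v' hv' b2 (by linarith)) (b4 v hv a2 (by linarith)))

open Classical in
/-- The graph joining consecutive points of `P` on the lines of `L`. -/
def lineGraph (P L : Finset (ℝ × ℝ)) : Finset ((ℝ × ℝ) × (ℝ × ℝ)) :=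
  (P ×ˢ P).filter fun e => ∃ ℓ ∈ L, ConsecutiveOn P ℓ e.1 e.2

lemma mem_lineGraph {P L : Finset (ℝ × ℝ)} {e : (ℝ × ℝ) × (ℝ × ℝ)} :
    e ∈ lineGraph P L ↔ (e.1 ∈ P ∧ e.2 ∈ P) ∧ ∃ ℓ ∈ L, ConsecutiveOn P ℓ e.1 e.2 := by
  simp [lineGraph]

lemma isGeometricGraph_lineGraph {P : Finset (ℝ × ℝ)} (L : Finset (ℝ × ℝ))
    (hP : Set.InjOn Prod.fst (P : Set (ℝ × ℝ))) : IsGeometricGraph P (lineGraph P L) where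
  injOn := hP
  left_mem e he := (mem_lineGraph.mp he).1.1
  right_mem e he := (mem_lineGraph.mp he).1.2
  lt e he := by
    obtain ⟨-, ℓ, -, h⟩ := mem_lineGraph.mp he
    exact h.2.2.1
  notMem_interior e he z hz h1 h2 h3 := by
    obtain ⟨-, ℓ, -, h⟩ := mem_lineGraph.mp he
    have h4 : segHeight e z.1 = ℓ.1 * z.1 + ℓ.2 := h.segHeight_eq z.1
    linarith [h.2.2.2 z hz (by rw [← h3, h4]) h1]

/-- Two lines cross at most once, so there are at most `#L ^ 2` ordered crossings. -/
lemma card_crossingPairs_lineGraph_le {P : Finset (ℝ × ℝ)} (L : Finset (ℝ × ℝ))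
    (hP : Set.InjOn Prod.fst (P : Set (ℝ × ℝ))) :
    (crossingPairs (lineGraph P L)).card ≤ L.card ^ 2 := by
  have hline : ∀ e ∈ lineGraph P L, ∃ ℓ ∈ L, ConsecutiveOn P ℓ e.1 e.2 :=
    fun e he => (mem_lineGraph.mp he).2
  choose! ℓ hℓL hℓ using hline
  have hmem : ∀ q ∈ crossingPairs (lineGraph P L),
      q.1 ∈ lineGraph P L ∧ q.2 ∈ lineGraph P L ∧ SegCross q.1 q.2 := fun q hq => by
    simpa [crossingPairs, and_assoc] using hq
  rw [sq, ← Finset.card_product]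
  refine Finset.card_le_card_of_injOn (fun q => (ℓ q.1, ℓ q.2)) (fun q hq => ?_) ?_
  · obtain ⟨h1, h2, -⟩ := hmem q hq
    exact Finset.mem_coe.mpr (Finset.mem_product.mpr ⟨hℓL _ h1, hℓL _ h2⟩)
  have hG := isGeometricGraph_lineGraph L hP
  have same : ∀ e ∈ lineGraph P L, ∀ f ∈ lineGraph P L, ℓ e = ℓ f → ∀ x, e.1.1 < x → x < e.2.1 →
      f.1.1 < x → x < f.2.1 → e = f := by
    intro e he f hf hef x h1 h2 h3 h4
    have hf' := hℓ f hf
    rw [← hef] at hf'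
    obtain ⟨k1, k2⟩ := (hℓ e he).eq_of_mem_interior hP hf' (hG.left_mem e he)
      (hG.right_mem e he) (hG.left_mem f hf) (hG.right_mem f hf) h1 h2 h3 h4
    exact Prod.ext k1 k2
  rintro ⟨e, f⟩ hq ⟨e', f'⟩ hq' heq
  obtain ⟨he, hf, hne, x, h1, h2, h3, h4, h5⟩ := hmem _ hq
  obtain ⟨he', hf', hne', x', h1', h2', h3', h4', h5'⟩ := hmem _ hq'
  simp only [Prod.mk.injEq] at heq
  dsimp only at he hf hne h1 h2 h3 h4 h5 he' hf' hne' h1' h2' h3' h4' h5'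
  have hh : ∀ g ∈ lineGraph P L, ∀ y, segHeight g y = (ℓ g).1 * y + (ℓ g).2 :=
    fun g hg y => (hℓ g hg).segHeight_eq y
  rw [hh e he, hh f hf] at h5
  rw [hh e' he', hh f' hf', ← heq.1, ← heq.2] at h5'
  have hxx : x = x' := by
    by_contra hx
    have hs : ((ℓ e).1 - (ℓ f).1) * (x - x') = 0 := by linear_combination h5 - h5'
    have hs : (ℓ e).1 = (ℓ f).1 := by
      rcases mul_eq_zero.mp hs with h | h
      · linarith
      · exact absurd (by linarith) hx
    have hc : (ℓ e).2 = (ℓ f).2 := by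
      rw [hs] at h5
      linarith
    exact hne (same e he f hf (Prod.ext hs hc) x h1 h3 h2 h4)
  subst hxx
  exact Prod.ext (same e he e' he' heq.1 x h1 h3 h1' h3') (same f hf f' hf' heq.2 x h2 h4 h2' h4')

open Classical in
/-- Incidences between points and non-vertical lines. -/
def lineIncidences (P L : Finset (ℝ × ℝ)) : Finset ((ℝ × ℝ) × (ℝ × ℝ)) :=
  (P ×ˢ L).filter fun q => q.1.2 = q.2.1 * q.1.1 + q.2.2

lemma card_lineIncidences_le (P L : Finset (ℝ × ℝ)) :
    (lineIncidences P L).card ≤ (lineGraph P L).card + L.card := by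
  classical
  have hmem : ∀ q ∈ lineIncidences P L, q.1 ∈ P ∧ q.2 ∈ L ∧ q.1.2 = q.2.1 * q.1.1 + q.2.2 :=
    fun q hq => by simpa [lineIncidences, and_assoc] using hq
  set A := (lineIncidences P L).filter fun q => ∃ v ∈ P, ConsecutiveOn P q.2 q.1 v with hA
  set B := (lineIncidences P L).filter fun q => ¬ ∃ v ∈ P, ConsecutiveOn P q.2 q.1 v with hB
  have hAB : A.card + B.card = (lineIncidences P L).card :=
    Finset.card_filter_add_card_filter_not _
  have cardA : A.card ≤ (lineGraph P L).card := by
    have hex : ∀ q ∈ A, ∃ v ∈ P, ConsecutiveOn P q.2 q.1 v :=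
      fun q hq => (Finset.mem_filter.mp hq).2
    choose! v hvP hv using hex
    refine Finset.card_le_card_of_injOn (fun q => (q.1, v q)) (fun q hq => ?_) ?_
    · obtain ⟨h1, h2, -⟩ := hmem q (Finset.mem_filter.mp hq).1
      exact Finset.mem_coe.mpr (mem_lineGraph.mpr ⟨⟨h1, hvP q hq⟩, q.2, h2, hv q hq⟩)
    · rintro ⟨p, ℓ⟩ hq ⟨p', ℓ'⟩ hq' heq
      simp only [Prod.mk.injEq] at heq
      obtain ⟨rfl, hvv⟩ := heq
      obtain ⟨a1, a2, a3, -⟩ := hv _ hq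
      obtain ⟨b1, b2, -, -⟩ := hv _ hq'
      rw [← hvv] at b2
      dsimp only at a1 a2 a3 b1 b2
      have hs : (ℓ.1 - ℓ'.1) * ((v (p, ℓ)).1 - p.1) = 0 := by
        linear_combination b2 - a2 + a1 - b1
      have hs : ℓ.1 = ℓ'.1 := by
        rcases mul_eq_zero.mp hs with h | h <;> linarith
      have hc : ℓ.2 = ℓ'.2 := by
        rw [hs] at a1
        linarith
      exact Prod.ext rfl (Prod.ext hs hc)
  have cardB : B.card ≤ L.card := by
    have last : ∀ q ∈ B, ∀ w ∈ P, w.2 = q.2.1 * w.1 + q.2.2 → w.1 ≤ q.1.1 := by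
      intro q hq w hw hwl
      obtain ⟨hq, hno⟩ := Finset.mem_filter.mp hq
      by_contra! hlt
      have hne : (P.filter fun w => w.2 = q.2.1 * w.1 + q.2.2 ∧ q.1.1 < w.1).Nonempty :=
        ⟨w, Finset.mem_filter.mpr ⟨hw, hwl, hlt⟩⟩
      obtain ⟨v, hv, hvmin⟩ := Finset.exists_min_image _ Prod.fst hne
      obtain ⟨hvP, hvl, hvlt⟩ := Finset.mem_filter.mp hv
      exact hno ⟨v, hvP, (hmem q hq).2.2, hvl, hvlt, fun w hw h1 h2 =>
        hvmin w (Finset.mem_filter.mpr ⟨hw, h1, h2⟩)⟩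
    refine Finset.card_le_card_of_injOn Prod.snd
      (fun q hq => (hmem q (Finset.mem_filter.mp hq).1).2.1) ?_
    rintro ⟨p, ℓ⟩ hq ⟨p', ℓ'⟩ hq' heq
    obtain rfl : ℓ = ℓ' := heq
    obtain ⟨a1, -, a2⟩ := hmem _ (Finset.mem_filter.mp hq).1
    obtain ⟨b1, -, b2⟩ := hmem _ (Finset.mem_filter.mp hq').1
    have h1 : p.1 = p'.1 := le_antisymm (last _ hq' p a1 a2) (last _ hq p' b1 b2)
    dsimp only at a2 b2
    exact Prod.ext (Prod.ext h1 (by rw [a2, b2, h1])) rfl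
  omega

/-- **Szemerédi–Trotter** for `n` points with distinct abscissas and `n` non-vertical lines. -/
theorem card_lineIncidences_le_rpow {P L : Finset (ℝ × ℝ)} {n : ℕ}
    (hP : Set.InjOn Prod.fst (P : Set (ℝ × ℝ))) (hPn : P.card ≤ n) (hLn : L.card ≤ n) :
    ((lineIncidences P L).card : ℝ) ≤ 7 * (n : ℝ) ^ ((4 : ℝ) / 3) := by
  have hG := isGeometricGraph_lineGraph L hP
  have hX := card_crossingPairs_lineGraph_le L hP
  have hI := card_lineIncidences_le P L
  rcases Nat.eq_zero_or_pos n with rfl | hn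
  · have : P = ∅ := by simpa using hPn
    simp [this, lineIncidences]
  have hn1 : (1 : ℝ) ≤ n := by exact_mod_cast hn
  have hP' : (P.card : ℝ) ≤ n := by exact_mod_cast hPn
  have hL' : (L.card : ℝ) ≤ n := by exact_mod_cast hLn
  have hX' : ((crossingPairs (lineGraph P L)).card : ℝ) ≤ (n : ℝ) ^ 2 :=
    calc _ ≤ (L.card : ℝ) ^ 2 := by exact_mod_cast hX
      _ ≤ _ := by gcongr
  have hI' : ((lineIncidences P L).card : ℝ) ≤ (lineGraph P L).card + L.card := by
    exact_mod_cast hI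
  have hnr : (n : ℝ) ≤ (n : ℝ) ^ ((4 : ℝ) / 3) :=
    Real.self_le_rpow_of_one_le hn1 (by norm_num)
  have hcube : ((lineGraph P L).card : ℝ) ^ 3 ≤ (6 * (n : ℝ) ^ ((4 : ℝ) / 3)) ^ 3 := by
    have hr : (6 * (n : ℝ) ^ ((4 : ℝ) / 3)) ^ 3 = 216 * (n : ℝ) ^ 4 := by
      rw [mul_pow, ← Real.rpow_natCast ((n : ℝ) ^ ((4 : ℝ) / 3)) 3,
        ← Real.rpow_mul (by positivity), ← Real.rpow_natCast (n : ℝ) 4]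
      norm_num
    rw [hr]
    rcases le_total (6 * P.card) (lineGraph P L).card with h | h
    · calc _ ≤ 72 * (P.card : ℝ) ^ 2 * (crossingPairs (lineGraph P L)).card :=
            hG.card_pow_three_le h
        _ ≤ 72 * (n : ℝ) ^ 2 * (n : ℝ) ^ 2 := by gcongr
        _ ≤ _ := by nlinarith [pow_pos (by linarith : (0 : ℝ) < n) 4]
    · have h' : ((lineGraph P L).card : ℝ) ≤ 6 * n := by
        have : ((lineGraph P L).card : ℝ) ≤ 6 * P.card := by exact_mod_cast h
        linarith
      calc _ ≤ (6 * (n : ℝ)) ^ 3 := by gcongr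
        _ ≤ _ := by
          nlinarith [mul_le_mul_of_nonneg_left hn1 (by positivity : 0 ≤ (n : ℝ) ^ 3)]
  have := le_of_pow_le_pow_left₀ (by norm_num) (by positivity) hcube
  linarith

lemma exists_forall_add_mul_ne_zero (D : Finset (ℝ × ℝ)) :
    ∃ t : ℝ, ∀ d ∈ D, d ≠ 0 → d.1 + t * d.2 ≠ 0 := by
  classical
  obtain ⟨t, ht⟩ := Infinite.exists_notMem_finset (D.image fun d => -d.1 / d.2)
  refine ⟨t, fun d hd hd0 h => ?_⟩
  by_cases h2 : d.2 = 0
  · exact hd0 (Prod.ext (by simpa [h2] using h) h2)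
  · refine ht (Finset.mem_image.mpr ⟨d, hd, ?_⟩)
    rw [div_eq_iff h2]
    linarith

lemma Pt2.inner_eq (p q : Pt2) : ⟪p, q⟫_ℝ = p 0 * q 0 + p 1 * q 1 := by
  simp [PiLp.inner_apply, Fin.sum_univ_two, mul_comm]

lemma Pt2.ext_coords {p q : Pt2} (h0 : p 0 = q 0) (h1 : p 1 = q 1) : p = q := by
  ext i
  fin_cases i
  · exact h0
  · exact h1

open Classical in
/-- Ordered pairs of points of `E` with dot product `α`. -/
def dotPairs (E : Finset Pt2) (α : ℝ) : Finset (Pt2 × Pt2) :=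
  (E ×ˢ E).filter fun q => ⟪q.1, q.2⟫_ℝ = α

theorem card_dotPairs_le {E : Finset Pt2} {α : ℝ} (hα : α ≠ 0) :
    ((dotPairs E α).card : ℝ) ≤ 7 * (E.card : ℝ) ^ ((4 : ℝ) / 3) := by
  classical
  obtain ⟨t, ht⟩ := exists_forall_add_mul_ne_zero
    (E.image (fun p => (p 1, -p 0)) ∪
      (E ×ˢ E).image (fun q => (q.1 0 - q.2 0, q.1 1 - q.2 1)))
  have ht1 : ∀ p ∈ E, p ≠ 0 → p 1 - t * p 0 ≠ 0 := by
    intro p hp hp0 h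
    refine ht _ (Finset.mem_union_left _ (Finset.mem_image_of_mem _ hp)) (fun h0 => hp0 ?_)
      (by simpa [sub_eq_add_neg] using h)
    simp only [Prod.mk_eq_zero, neg_eq_zero] at h0
    exact Pt2.ext_coords (by simpa using h0.2) (by simpa using h0.1)
  have ht2 : ∀ p ∈ E, ∀ q ∈ E, p 0 + t * p 1 = q 0 + t * q 1 → p = q := by
    intro p hp q hq h
    by_contra hpq
    refine ht _ (Finset.mem_union_right _ (Finset.mem_image_of_mem _
      (Finset.mem_product.mpr ⟨hp, hq⟩ : (p, q) ∈ E ×ˢ E))) (fun h0 => hpq ?_)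
      (by dsimp only; linarith)
    simp only [Prod.mk_eq_zero, sub_eq_zero] at h0
    exact Pt2.ext_coords h0.1 h0.2
  -- After a shear, `q` becomes `φ q` and the line `p · q = α` becomes `ℓ p`.
  set φ : Pt2 → ℝ × ℝ := fun q => (q 0 + t * q 1, q 1) with hφ
  set ℓ : Pt2 → ℝ × ℝ := fun p => (-p 0 / (p 1 - t * p 0), α / (p 1 - t * p 0)) with hℓ
  have hℓinj : ∀ p ∈ E, ∀ q ∈ E, p ≠ 0 → q ≠ 0 → ℓ p = ℓ q → p = q := by
    intro p hp q hq hp0 hq0 h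
    have kp := ht1 p hp hp0
    have kq := ht1 q hq hq0
    simp only [hℓ, Prod.mk.injEq] at h
    obtain ⟨h1, h2⟩ := h
    rw [div_eq_div_iff kp kq] at h1 h2
    have hk : p 1 - t * p 0 = q 1 - t * q 0 := (mul_left_cancel₀ hα h2).symm
    rw [hk] at h1
    have h0 := mul_right_cancel₀ kq h1
    have h0 : p 0 = q 0 := by linarith
    exact Pt2.ext_coords h0 (by rw [h0] at hk; linarith)
  have hinjP : Set.InjOn Prod.fst ((E.image φ : Finset (ℝ × ℝ)) : Set (ℝ × ℝ)) := by
    intro a ha b hb hab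
    obtain ⟨p, hp, rfl⟩ := Finset.mem_image.mp ha
    obtain ⟨q, hq, rfl⟩ := Finset.mem_image.mp hb
    rw [ht2 p hp q hq hab]
  have hne : ∀ q ∈ dotPairs E α, q.1 ∈ E ∧ q.2 ∈ E ∧ ⟪q.1, q.2⟫_ℝ = α ∧ q.1 ≠ 0 := by
    intro q hq
    obtain ⟨hq, hqα⟩ := Finset.mem_filter.mp hq
    obtain ⟨h1, h2⟩ := Finset.mem_product.mp hq
    refine ⟨h1, h2, hqα, fun h => hα ?_⟩
    rw [← hqα, h, inner_zero_left]
  have hcard : (dotPairs E α).card ≤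
      (lineIncidences (E.image φ) ((E.filter (· ≠ 0)).image ℓ)).card := by
    refine Finset.card_le_card_of_injOn (fun q => (φ q.2, ℓ q.1)) (fun q hq => ?_) ?_
    · obtain ⟨h1, h2, h3, h4⟩ := hne q hq
      have k := ht1 _ h1 h4
      refine Finset.mem_coe.mpr (Finset.mem_filter.mpr ⟨Finset.mem_product.mpr
        ⟨Finset.mem_image_of_mem _ h2, Finset.mem_image_of_mem _
          (Finset.mem_filter.mpr ⟨h1, h4⟩)⟩, ?_⟩)
      rw [Pt2.inner_eq] at h3
      simp only [hφ, hℓ]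
      rw [div_mul_eq_mul_div, ← add_div, eq_div_iff k]
      linear_combination h3
    · rintro ⟨p, q⟩ hq ⟨p', q'⟩ hq' heq
      obtain ⟨h1, h2, -, h4⟩ := hne _ hq
      obtain ⟨h1', h2', -, h4'⟩ := hne _ hq'
      simp only [Prod.mk.injEq] at heq
      refine Prod.ext (hℓinj p h1 p' h1' h4 h4' heq.2) (ht2 q h2 q' h2' ?_)
      exact congrArg Prod.fst heq.1
  refine le_trans (by exact_mod_cast hcard)
    (card_lineIncidences_le_rpow hinjP Finset.card_image_le ?_)
  exact Finset.card_image_le.trans (Finset.card_filter_le _ _)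

/-- A point is determined by its dot products with two linearly independent vectors. -/
lemma Pt2.eq_of_inner_eq {p q x y : Pt2} (hdet : p 0 * q 1 - p 1 * q 0 ≠ 0)
    (hp : ⟪p, x⟫_ℝ = ⟪p, y⟫_ℝ) (hq : ⟪q, x⟫_ℝ = ⟪q, y⟫_ℝ) : x = y := by
  simp only [Pt2.inner_eq] at hp hq
  refine Pt2.ext_coords (mul_left_cancel₀ hdet ?_) (mul_left_cancel₀ hdet ?_)
  · linear_combination q 1 * hp - p 1 * hq
  · linear_combination p 0 * hq - q 0 * hp

/-- A point on the line spanned by `p ≠ 0` is determined by its dot product with `p`. -/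
lemma Pt2.eq_of_inner_eq_of_det_eq_zero {p x y : Pt2} (hp0 : p ≠ 0)
    (hx : p 0 * x 1 - p 1 * x 0 = 0) (hy : p 0 * y 1 - p 1 * y 0 = 0)
    (h : ⟪p, x⟫_ℝ = ⟪p, y⟫_ℝ) : x = y := by
  have hN : p 0 * p 0 + p 1 * p 1 ≠ 0 := by
    rw [← Pt2.inner_eq]
    exact inner_self_ne_zero.mpr hp0
  simp only [Pt2.inner_eq] at h
  refine Pt2.ext_coords (mul_left_cancel₀ hN ?_) (mul_left_cancel₀ hN ?_)
  · linear_combination p 0 * h - p 1 * hx + p 1 * hy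
  · linear_combination p 1 * h + p 0 * hx - p 0 * hy

lemma ncard_dpTriangles_le (E : Finset Pt2) {α₁ : ℝ} (h₁ : α₁ ≠ 0) (α₂ α₃ : ℝ) :
    (dpTriangles E α₁ α₂ α₃).ncard ≤ (dotPairs E α₁).card + (dotPairs E α₃).card + E.card := by
  classical
  set T : Finset (Pt2 × Pt2 × Pt2) := (E ×ˢ E ×ˢ E).filter fun x =>
    ⟪x.1, x.2.1⟫_ℝ = α₁ ∧ ⟪x.2.1, x.2.2⟫_ℝ = α₂ ∧ ⟪x.2.2, x.1⟫_ℝ = α₃ with hT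
  have hmem : ∀ x ∈ T, (x.1 ∈ E ∧ x.2.1 ∈ E ∧ x.2.2 ∈ E) ∧
      ⟪x.1, x.2.1⟫_ℝ = α₁ ∧ ⟪x.2.1, x.2.2⟫_ℝ = α₂ ∧ ⟪x.2.2, x.1⟫_ℝ = α₃ :=
    fun x hx => by simpa only [hT, Finset.mem_filter, Finset.mem_product] using hx
  have hsub : dpTriangles E α₁ α₂ α₃ ⊆ T := by
    rintro x ⟨h1, h2, h3, -, -, -, h⟩
    simp only [hT, Finset.coe_filter, Finset.mem_product, Set.mem_ofPred_eq]
    exact ⟨⟨h1, h2, h3⟩, h⟩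
  have hTcard : (dpTriangles E α₁ α₂ α₃).ncard ≤ T.card := by
    rw [← Set.ncard_coe_finset]
    exact Set.ncard_le_ncard hsub
  set A := T.filter fun x => x.1 0 * x.2.1 1 - x.1 1 * x.2.1 0 ≠ 0
  set A' := T.filter fun x => ¬ x.1 0 * x.2.1 1 - x.1 1 * x.2.1 0 ≠ 0
  set B := A'.filter fun x => x.1 0 * x.2.2 1 - x.1 1 * x.2.2 0 ≠ 0
  set C := A'.filter fun x => ¬ x.1 0 * x.2.2 1 - x.1 1 * x.2.2 0 ≠ 0
  have hAA' : A.card + A'.card = T.card := Finset.card_filter_add_card_filter_not _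
  have hBC : B.card + C.card = A'.card := Finset.card_filter_add_card_filter_not _
  have cardA : A.card ≤ (dotPairs E α₁).card := by
    refine Finset.card_le_card_of_injOn (fun x => (x.1, x.2.1)) (fun x hx => ?_) ?_
    · obtain ⟨⟨h1, h2, -⟩, h, -⟩ := hmem x (Finset.mem_filter.mp hx).1
      exact Finset.mem_coe.mpr (Finset.mem_filter.mpr ⟨Finset.mem_product.mpr ⟨h1, h2⟩, h⟩)
    · rintro ⟨x, y, z⟩ hx ⟨x', y', z'⟩ hx' heq
      simp only [Prod.mk.injEq] at heq
      obtain ⟨rfl, rfl⟩ := heq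
      obtain ⟨hx, hdet⟩ := Finset.mem_filter.mp hx
      obtain ⟨-, -, h2, h3⟩ := hmem _ hx
      obtain ⟨-, -, h2', h3'⟩ := hmem _ (Finset.mem_filter.mp hx').1
      rw [real_inner_comm] at h3 h3'
      exact Prod.ext rfl (Prod.ext rfl
        (Pt2.eq_of_inner_eq hdet (h3.trans h3'.symm) (h2.trans h2'.symm)))
  have cardB : B.card ≤ (dotPairs E α₃).card := by
    refine Finset.card_le_card_of_injOn (fun x => (x.2.2, x.1)) (fun x hx => ?_) ?_
    · obtain ⟨⟨h1, -, h2⟩, -, -, h⟩ :=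
        hmem x (Finset.mem_filter.mp (Finset.mem_filter.mp hx).1).1
      exact Finset.mem_coe.mpr (Finset.mem_filter.mpr ⟨Finset.mem_product.mpr ⟨h2, h1⟩, h⟩)
    · rintro ⟨x, y, z⟩ hx ⟨x', y', z'⟩ hx' heq
      simp only [Prod.mk.injEq] at heq
      obtain ⟨rfl, rfl⟩ := heq
      obtain ⟨hx, hdet⟩ := Finset.mem_filter.mp hx
      obtain ⟨-, h1, h2, -⟩ := hmem _ (Finset.mem_filter.mp hx).1
      obtain ⟨-, h1', h2', -⟩ := hmem _ (Finset.mem_filter.mp (Finset.mem_filter.mp hx').1).1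
      rw [real_inner_comm] at h2 h2'
      exact Prod.ext rfl (Prod.ext
        (Pt2.eq_of_inner_eq hdet (h1.trans h1'.symm) (h2.trans h2'.symm)) rfl)
  have cardC : C.card ≤ E.card := by
    refine Finset.card_le_card_of_injOn Prod.fst (fun x hx =>
      (hmem x (Finset.mem_filter.mp (Finset.mem_filter.mp hx).1).1).1.1) ?_
    rintro ⟨x, y, z⟩ hx ⟨x', y', z'⟩ hx' heq
    obtain rfl : x = x' := heq
    obtain ⟨hx, hz⟩ := Finset.mem_filter.mp hx
    obtain ⟨hx, hy⟩ := Finset.mem_filter.mp hx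
    obtain ⟨hx', hz'⟩ := Finset.mem_filter.mp hx'
    obtain ⟨hx', hy'⟩ := Finset.mem_filter.mp hx'
    obtain ⟨-, h1, -, h3⟩ := hmem _ hx
    obtain ⟨-, h1', -, h3'⟩ := hmem _ hx'
    rw [real_inner_comm] at h3 h3'
    have hx0 : x ≠ 0 := by
      rintro rfl
      exact h₁ (by rw [← h1, inner_zero_left])
    rw [not_not] at hy hz hy' hz'
    exact Prod.ext rfl (Prod.ext
      (Pt2.eq_of_inner_eq_of_det_eq_zero hx0 hy hy' (h1.trans h1'.symm))
      (Pt2.eq_of_inner_eq_of_det_eq_zero hx0 hz hz' (h3.trans h3'.symm)))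
  omega

/-- **upper bound in Theorem on dot product triangles.** For any nonzero
reals `α₁, α₂, α₃` there is a constant `C > 0` such that every set of `n` points in the
plane contains at most `C · n^(4/3)` dot product triangles of type `(α₁, α₂, α₃)`. -/
theorem dpTriangle_upper_bound (α₁ α₂ α₃ : ℝ) (h₁ : α₁ ≠ 0) (h₂ : α₂ ≠ 0) (h₃ : α₃ ≠ 0) :
    ∃ C : ℝ, 0 < C ∧ ∀ (n : ℕ) (E : Finset Pt2), E.card = n →
      ((dpTriangles E α₁ α₂ α₃).ncard : ℝ) ≤ C * (n : ℝ) ^ ((4 : ℝ) / 3) := by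
  refine ⟨15, by norm_num, ?_⟩
  rintro n E rfl
  have hT : ((dpTriangles E α₁ α₂ α₃).ncard : ℝ) ≤
      (dotPairs E α₁).card + (dotPairs E α₃).card + E.card := by
    exact_mod_cast ncard_dpTriangles_le E h₁ α₂ α₃
  have hn : (E.card : ℝ) ≤ (E.card : ℝ) ^ ((4 : ℝ) / 3) := by
    rcases Nat.eq_zero_or_pos E.card with h | h
    · simp [h]
    · exact Real.self_le_rpow_of_one_le (by exact_mod_cast h) (by norm_num)
  linarith [card_dotPairs_le (E := E) h₁, card_dotPairs_le (E := E) h₃]
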